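/- arXiv:hep-th/0207233 — 4 statements merged into one kernel-verified Lean document; each statement's English description precedes it below -/
import Mathlib

section
/- For conformal weight ℓ = 1, the conformal algebra so(4,2) is a symmetry algebra of the massless Klein–Gordon (wave) equation: if φ : (Fin 4 → ℝ) → ℝ is smooth and □φ = 0, then □(Xφ) = 0 for each of the fifteen conformal operators X ∈ {J_1,J_2,J_3, P_0,P_1,P_2,P_3, K_1,K_2,K_3, D, C_0,C_1,C_2,C_3}. -/
noncomputable section

/-- Real-valued functions on `ℝ⁴` (encoded as `Fin 4 → ℝ`). -/
abbrev F : Type := (Fin 4 → ℝ) → ℝ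

/-- Directional derivative `∂_μ` along the `μ`-th standard basis vector. -/
def pdf (μ : Fin 4) (φ : F) : F := fun x => fderiv ℝ φ x (Pi.single μ 1)

/-- Multiplication operator by the coordinate `x^μ`. -/
def mxf (μ : Fin 4) (φ : F) : F := fun x => x μ * φ x

/-- Levi-Civita symbol with `ε_{123} = 1`, indices encoded as `Fin 3`. -/
def eps (i j k : Fin 3) : ℝ :=
  ((j.val : ℝ) - (i.val : ℝ)) * ((k.val : ℝ) - (i.val : ℝ)) * ((k.val : ℝ) - (j.val : ℝ)) / 2

def sJ (i : Fin 3) (φ : F) : F := ∑ j : Fin 3, ∑ k : Fin 3, eps i j k • mxf k.succ (pdf j.succ φ)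
def sK (i : Fin 3) (φ : F) : F := -mxf i.succ (pdf 0 φ) - mxf 0 (pdf i.succ φ)
/-- `Σ_μ x^μ ∂_μ + ℓ` with conformal weight `ℓ = 1`. -/
def sE (φ : F) : F := (∑ μ : Fin 4, mxf μ (pdf μ φ)) + φ
def sD (φ : F) : F := -(∑ μ : Fin 4, mxf μ (pdf μ φ)) - φ
def Qf : (Fin 4 → ℝ) → ℝ := fun x => (x 0)^2 - (x 1)^2 - (x 2)^2 - (x 3)^2
def sC0 (φ : F) : F := (1/2 : ℝ) • (fun x => Qf x * pdf 0 φ x) - mxf 0 (sE φ)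
def sC (i : Fin 3) (φ : F) : F := (1/2 : ℝ) • (fun x => Qf x * pdf i.succ φ x) + mxf i.succ (sE φ)
/-- The d'Alembertian `□ = ∂_0² − ∂_1² − ∂_2² − ∂_3²`. -/
def boxf (φ : F) : F := pdf 0 (pdf 0 φ) - pdf 1 (pdf 1 φ) - pdf 2 (pdf 2 φ) - pdf 3 (pdf 3 φ)

open scoped ContDiff

section PartialDerivatives

variable {φ ψ : F}

theorem contDiff_pdf (hφ : ContDiff ℝ ∞ φ) (μ : Fin 4) : ContDiff ℝ ∞ (pdf μ φ) :=
  (hφ.fderiv_right (m := ∞) le_rfl).clm_apply contDiff_const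

theorem contDiff_mxf (hφ : ContDiff ℝ ∞ φ) (μ : Fin 4) : ContDiff ℝ ∞ (mxf μ φ) :=
  (contDiff_apply ℝ ℝ μ).mul hφ

theorem contDiff_smul_fun (hφ : ContDiff ℝ ∞ φ) (c : ℝ) : ContDiff ℝ ∞ (c • φ) :=
  hφ.const_smul c

theorem contDiff_sum_fun {ι : Type*} (s : Finset ι) {f : ι → F} (hf : ∀ i, ContDiff ℝ ∞ (f i)) :
    ContDiff ℝ ∞ (∑ i ∈ s, f i) := by
  convert ContDiff.sum (s := s) fun i _ => hf i using 1
  ext x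
  simp

theorem contDiff_euler (hφ : ContDiff ℝ ∞ φ) : ContDiff ℝ ∞ (∑ μ : Fin 4, mxf μ (pdf μ φ)) :=
  contDiff_sum_fun _ fun μ => contDiff_mxf (contDiff_pdf hφ μ) μ

theorem contDiff_sE (hφ : ContDiff ℝ ∞ φ) : ContDiff ℝ ∞ (sE φ) :=
  (contDiff_euler hφ).add hφ

theorem differentiableAt_of_smooth (hφ : ContDiff ℝ ∞ φ) (x : Fin 4 → ℝ) :
    DifferentiableAt ℝ φ x :=
  hφ.differentiable (by simp) x

theorem pdf_zero (μ : Fin 4) : pdf μ 0 = 0 := by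
  ext x
  simp [pdf]

theorem pdf_add (hφ : ContDiff ℝ ∞ φ) (hψ : ContDiff ℝ ∞ ψ) (μ : Fin 4) :
    pdf μ (φ + ψ) = pdf μ φ + pdf μ ψ := by
  ext x
  simp [pdf, fderiv_add (differentiableAt_of_smooth hφ x) (differentiableAt_of_smooth hψ x)]

theorem pdf_sub (hφ : ContDiff ℝ ∞ φ) (hψ : ContDiff ℝ ∞ ψ) (μ : Fin 4) :
    pdf μ (φ - ψ) = pdf μ φ - pdf μ ψ := by
  ext x
  simp [pdf, fderiv_sub (differentiableAt_of_smooth hφ x) (differentiableAt_of_smooth hψ x)]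

theorem pdf_smul (hφ : ContDiff ℝ ∞ φ) (c : ℝ) (μ : Fin 4) : pdf μ (c • φ) = c • pdf μ φ := by
  ext x
  simp [pdf, fderiv_const_smul (differentiableAt_of_smooth hφ x) c]

theorem pdf_sum {ι : Type*} (s : Finset ι) {f : ι → F} (hf : ∀ i, ContDiff ℝ ∞ (f i))
    (μ : Fin 4) : pdf μ (∑ i ∈ s, f i) = ∑ i ∈ s, pdf μ (f i) := by
  ext x
  simp [pdf, fderiv_sum fun i _ => differentiableAt_of_smooth (hf i) x]

theorem pdf_mxf (hφ : ContDiff ℝ ∞ φ) (μ ν : Fin 4) :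
    pdf μ (mxf ν φ) = mxf ν (pdf μ φ) + (if μ = ν then 1 else 0 : ℝ) • φ := by
  ext x
  have h := (hasFDerivAt_apply (𝕜 := ℝ) ν x).mul (differentiableAt_of_smooth hφ x).hasFDerivAt
  have h' : fderiv ℝ (mxf ν φ) x = _ := h.fderiv
  by_cases hμν : μ = ν <;> simp [pdf, h', mxf, hμν]

theorem pdf_comm (hφ : ContDiff ℝ ∞ φ) (μ ν : Fin 4) :
    pdf μ (pdf ν φ) = pdf ν (pdf μ φ) := by
  have key (μ ν : Fin 4) (x : Fin 4 → ℝ) : pdf μ (pdf ν φ) x =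
      fderiv ℝ (fderiv ℝ φ) x (Pi.single μ 1) (Pi.single ν 1) := by
    have hd : DifferentiableAt ℝ (fderiv ℝ φ) x :=
      (hφ.fderiv_right (m := ∞) le_rfl).differentiable (by simp) x
    have h := hd.hasFDerivAt.clm_apply (hasFDerivAt_const (Pi.single ν (1 : ℝ)) x)
    have h' : fderiv ℝ (pdf ν φ) x = _ := h.fderiv
    rw [pdf, h']
    simp
  ext x
  rw [key, key]
  exact (hφ.contDiffAt.isSymmSndFDerivAt (by simpa using ENat.LEInfty.out)).eq _ _

theorem pdf_sE (hφ : ContDiff ℝ ∞ φ) (μ : Fin 4) :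
    pdf μ (sE φ) = sE (pdf μ φ) + pdf μ φ := by
  have h (ν : Fin 4) : ContDiff ℝ ∞ (mxf ν (pdf ν φ)) := contDiff_mxf (contDiff_pdf hφ ν) ν
  rw [sE, pdf_add (contDiff_euler hφ) hφ, pdf_sum _ h, sE]
  simp [pdf_mxf (contDiff_pdf hφ _), pdf_comm hφ μ, Finset.sum_add_distrib]

end PartialDerivatives

section Dalembertian

variable {φ ψ : F}

/-- Diagonal entries of the Minkowski metric of signature `(+,-,-,-)`. -/
def minkowskiSign (μ : Fin 4) : ℝ := if μ = 0 then 1 else -1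

theorem boxf_eq_sum (φ : F) : boxf φ = ∑ μ : Fin 4, minkowskiSign μ • pdf μ (pdf μ φ) := by
  simp [boxf, minkowskiSign, Fin.sum_univ_four, sub_eq_add_neg]

theorem boxf_add (hφ : ContDiff ℝ ∞ φ) (hψ : ContDiff ℝ ∞ ψ) :
    boxf (φ + ψ) = boxf φ + boxf ψ := by
  simp [boxf_eq_sum, pdf_add hφ hψ, pdf_add (contDiff_pdf hφ _) (contDiff_pdf hψ _), Finset.sum_add_distrib]

theorem boxf_sub (hφ : ContDiff ℝ ∞ φ) (hψ : ContDiff ℝ ∞ ψ) :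
    boxf (φ - ψ) = boxf φ - boxf ψ := by
  simp [boxf_eq_sum, pdf_sub hφ hψ, pdf_sub (contDiff_pdf hφ _) (contDiff_pdf hψ _), smul_sub]

theorem boxf_smul (hφ : ContDiff ℝ ∞ φ) (c : ℝ) : boxf (c • φ) = c • boxf φ := by
  simp [boxf_eq_sum, pdf_smul hφ, pdf_smul (contDiff_pdf hφ _), Finset.smul_sum, smul_comm c]

theorem boxf_neg (hφ : ContDiff ℝ ∞ φ) : boxf (-φ) = -boxf φ := by
  simpa using boxf_smul hφ (-1)

theorem boxf_sum {ι : Type*} (s : Finset ι) {f : ι → F} (hf : ∀ i, ContDiff ℝ ∞ (f i)) :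
    boxf (∑ i ∈ s, f i) = ∑ i ∈ s, boxf (f i) := by
  simp only [boxf_eq_sum, pdf_sum s hf, pdf_sum s fun i => contDiff_pdf (hf i) _, Finset.smul_sum]
  exact Finset.sum_comm

theorem boxf_pdf (hφ : ContDiff ℝ ∞ φ) (μ : Fin 4) : boxf (pdf μ φ) = pdf μ (boxf φ) := by
  have h (ν : Fin 4) := contDiff_pdf (contDiff_pdf hφ ν) ν
  simp only [boxf_eq_sum]
  rw [pdf_sum _ fun ν => contDiff_smul_fun (h ν) (minkowskiSign ν)]
  refine Finset.sum_congr rfl fun ν _ => ?_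
  rw [pdf_smul (h ν), pdf_comm hφ ν μ, pdf_comm (contDiff_pdf hφ ν) ν μ]

theorem boxf_mxf (hφ : ContDiff ℝ ∞ φ) (μ : Fin 4) :
    boxf (mxf μ φ) = mxf μ (boxf φ) + (2 * minkowskiSign μ) • pdf μ φ := by
  have h (ν : Fin 4) : pdf ν (pdf ν (mxf μ φ)) =
      mxf μ (pdf ν (pdf ν φ)) + (2 * if ν = μ then 1 else 0 : ℝ) • pdf ν φ := by
    rw [pdf_mxf hφ, pdf_add (contDiff_mxf (contDiff_pdf hφ ν) μ) (contDiff_smul_fun hφ _),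
      pdf_mxf (contDiff_pdf hφ ν), pdf_smul hφ]
    module
  simp only [boxf_eq_sum, h, smul_add, Finset.sum_add_distrib]
  congr 1
  · ext x
    simp [mxf, Finset.mul_sum, mul_left_comm]
  · simp [smul_smul, mul_comm]

theorem boxf_sE (hφ : ContDiff ℝ ∞ φ) : boxf (sE φ) = sE (boxf φ) + (2 : ℝ) • boxf φ := by
  have h (μ : Fin 4) : boxf (mxf μ (pdf μ φ)) =
      mxf μ (pdf μ (boxf φ)) + (2 : ℝ) • minkowskiSign μ • pdf μ (pdf μ φ) := by
    rw [boxf_mxf (contDiff_pdf hφ μ), boxf_pdf hφ, mul_smul]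
  rw [sE, boxf_add (contDiff_euler hφ) hφ,
    boxf_sum _ fun μ => contDiff_mxf (contDiff_pdf hφ μ) μ]
  simp only [h, Finset.sum_add_distrib, ← Finset.smul_sum, ← boxf_eq_sum, sE]
  abel

theorem Qf_mul_eq_sum (φ : F) :
    (fun x => Qf x * φ x) = ∑ μ : Fin 4, minkowskiSign μ • mxf μ (mxf μ φ) := by
  ext x
  simp [Qf, minkowskiSign, mxf, Fin.sum_univ_four]
  ring

theorem minkowskiSign_mul_self (μ : Fin 4) : minkowskiSign μ * minkowskiSign μ = 1 := by
  unfold minkowskiSign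
  split_ifs <;> norm_num

theorem boxf_Qf_mul (hφ : ContDiff ℝ ∞ φ) :
    boxf (fun x => Qf x * φ x) =
      (fun x => Qf x * boxf φ x) + (4 : ℝ) • sE φ + (4 : ℝ) • φ := by
  have hm (μ : Fin 4) : ContDiff ℝ ∞ (mxf μ (mxf μ φ)) := contDiff_mxf (contDiff_mxf hφ μ) μ
  have h (μ : Fin 4) : minkowskiSign μ • boxf (mxf μ (mxf μ φ)) =
      minkowskiSign μ • mxf μ (mxf μ (boxf φ)) + (4 : ℝ) • mxf μ (pdf μ φ) + (2 : ℝ) • φ := by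
    rw [boxf_mxf (contDiff_mxf hφ μ), boxf_mxf hφ, pdf_mxf hφ]
    ext x
    simp [mxf]
    linear_combination (4 * x μ * pdf μ φ x + 2 * φ x) * minkowskiSign_mul_self μ
  rw [Qf_mul_eq_sum, boxf_sum _ fun μ => contDiff_smul_fun (hm μ) (minkowskiSign μ), Qf_mul_eq_sum]
  simp only [boxf_smul (hm _), h, Finset.sum_add_distrib, ← Finset.smul_sum, sE]
  ext x
  simp
  ring

theorem contDiff_Qf_mul (hφ : ContDiff ℝ ∞ φ) : ContDiff ℝ ∞ fun x => Qf x * φ x := by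
  have hQ : ContDiff ℝ ∞ Qf := by
    unfold Qf
    fun_prop
  exact hQ.mul hφ

/-- The special conformal generator along the `μ`-th axis, with lowered index on `x^μ`. -/
theorem boxf_special_conformal (hφ : ContDiff ℝ ∞ φ) (h : boxf φ = 0) (μ : Fin 4) :
    boxf ((1 / 2 : ℝ) • (fun x => Qf x * pdf μ φ x) - minkowskiSign μ • mxf μ (sE φ)) = 0 := by
  have hQ := contDiff_Qf_mul (contDiff_pdf hφ μ)
  have hE := contDiff_mxf (contDiff_sE hφ) μ
  rw [boxf_sub (contDiff_smul_fun hQ _) (contDiff_smul_fun hE _), boxf_smul hQ, boxf_smul hE,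
    boxf_Qf_mul (contDiff_pdf hφ μ), boxf_mxf (contDiff_sE hφ), boxf_sE hφ, boxf_pdf hφ, h,
    pdf_sE hφ]
  ext x
  simp [pdf_zero, mxf, sE]
  linear_combination (-2 * (∑ ν, x ν * pdf ν (pdf μ φ) x + 2 * pdf μ φ x)) *
    minkowskiSign_mul_self μ

theorem boxf_mxf_pdf (hφ : ContDiff ℝ ∞ φ) (h : boxf φ = 0) (μ ν : Fin 4) :
    boxf (mxf μ (pdf ν φ)) = (2 * minkowskiSign μ) • pdf μ (pdf ν φ) := by
  rw [boxf_mxf (contDiff_pdf hφ ν), boxf_pdf hφ, h, pdf_zero]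
  ext x
  simp [mxf]

theorem eps_swap (i j k : Fin 3) : eps i k j = -eps i j k := by
  unfold eps
  ring

theorem boxf_sJ (hφ : ContDiff ℝ ∞ φ) (h : boxf φ = 0) (i : Fin 3) : boxf (sJ i φ) = 0 := by
  have hm (j k : Fin 3) : ContDiff ℝ ∞ (mxf k.succ (pdf j.succ φ)) :=
    contDiff_mxf (contDiff_pdf hφ _) _
  have hs (j k : Fin 3) := contDiff_smul_fun (hm j k) (eps i j k)
  have ht (j : Fin 3) : ContDiff ℝ ∞ (∑ k : Fin 3, eps i j k • mxf k.succ (pdf j.succ φ)) :=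
    contDiff_sum_fun _ (hs j)
  have key : boxf (sJ i φ) =
      ∑ j : Fin 3, ∑ k : Fin 3, (-2 * eps i j k) • pdf k.succ (pdf j.succ φ) := by
    rw [sJ, boxf_sum _ ht]
    refine Finset.sum_congr rfl fun j _ => ?_
    rw [boxf_sum _ (hs j)]
    refine Finset.sum_congr rfl fun k _ => ?_
    rw [boxf_smul (hm j k), boxf_mxf_pdf hφ h, smul_smul]
    congr 1
    simp [minkowskiSign]
    ring
  have hneg : boxf (sJ i φ) = -boxf (sJ i φ) := by
    conv_lhs => rw [key, Finset.sum_comm]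
    simp only [key, ← Finset.sum_neg_distrib]
    refine Finset.sum_congr rfl fun j _ => Finset.sum_congr rfl fun k _ => ?_
    rw [eps_swap, pdf_comm hφ]
    module
  exact self_eq_neg.mp hneg

theorem boxf_sK (hφ : ContDiff ℝ ∞ φ) (h : boxf φ = 0) (i : Fin 3) : boxf (sK i φ) = 0 := by
  have h₁ := contDiff_mxf (contDiff_pdf hφ 0) i.succ
  have h₂ := contDiff_mxf (contDiff_pdf hφ i.succ) 0
  rw [sK, boxf_sub (φ := -_) h₁.neg h₂, boxf_neg h₁, boxf_mxf_pdf hφ h, boxf_mxf_pdf hφ h,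
    pdf_comm hφ 0 i.succ]
  simp [minkowskiSign]

end Dalembertian

/-- For conformal weight `ℓ = 1`, the fifteen conformal operators map solutions of the
massless Klein--Gordon (wave) equation to solutions. -/
theorem so42_symmetry_of_wave_equation (φ : F) (hφ : ContDiff ℝ (⊤ : ℕ∞) φ) (h : boxf φ = 0) :
    (∀ i : Fin 3, boxf (sJ i φ) = 0) ∧
    (∀ μ : Fin 4, boxf (pdf μ φ) = 0) ∧
    (∀ i : Fin 3, boxf (sK i φ) = 0) ∧
    boxf (sD φ) = 0 ∧
    boxf (sC0 φ) = 0 ∧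
    (∀ i : Fin 3, boxf (sC i φ) = 0) := by
  refine ⟨boxf_sJ hφ h, fun μ => ?_, boxf_sK hφ h, ?_, ?_, fun i => ?_⟩
  · rw [boxf_pdf hφ, h, pdf_zero]
  · have hD : sD φ = -sE φ := by
      rw [sD, sE]
      abel
    rw [hD, boxf_neg (contDiff_sE hφ), boxf_sE hφ, h]
    ext x
    simp [sE, mxf, pdf_zero]
  · simpa [sC0, minkowskiSign] using boxf_special_conformal hφ h 0
  · simpa [sC, minkowskiSign] using boxf_special_conformal hφ h i.succ
end
end

section
/- The operators A_2, A_3 and J_1, together with the carrier operators, satisfy exactly the following additional nonvanishing commutation relations (a,b ∈ {2,3}): [H_+,A_a] = (1/2)A_a, [H_−,A_a] = −(1/2)A_a, [A_a,T_a] = T_+, [A_a,T_−] = T_a, [J_1,A_a] = Σ_b ε_{1ab} A_b, [J_1,B_a] = Σ_b ε_{1ab} B_b, [J_1,T_a] = Σ_b ε_{1ab} T_b, [A_a,B_b] = δ_ab(H_+ − H_−) − ε_{1ab} J_1; all other commutators among {H_+,H_−,T_+,T_−,T_2,T_3,B_2,B_3,A_2,A_3,J_1} not listed here or in the carrier relations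 (and not obtained by antisymmetry) vanish, so these eleven operators close the Weyl–Poincaré subalgebra in the null-plane basis. -/
noncomputable section

abbrev 𝔸 : Type := Module.End ℝ (MvPolynomial (Fin 4) ℝ)

def pd (μ : Fin 4) : 𝔸 := (MvPolynomial.pderiv μ).toLinearMap
def mx (μ : Fin 4) : 𝔸 := LinearMap.mulLeft ℝ (MvPolynomial.X μ)
def Jgen (i : Fin 3) : 𝔸 := ∑ j : Fin 3, ∑ k : Fin 3, eps i j k • (mx k.succ * pd j.succ)
def Pgen (μ : Fin 4) : 𝔸 := pd μ
def Kgen (i : Fin 3) : 𝔸 := -(mx i.succ * pd 0) - mx 0 * pd i.succ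
def Ddil (l : ℝ) : 𝔸 := -(∑ μ : Fin 4, mx μ * pd μ) - l • (1 : 𝔸)
def Qop : 𝔸 := mx 0 * mx 0 - mx 1 * mx 1 - mx 2 * mx 2 - mx 3 * mx 3
def Egen (l : ℝ) : 𝔸 := (∑ μ : Fin 4, mx μ * pd μ) + l • (1 : 𝔸)
def C0gen (l : ℝ) : 𝔸 := (1/2 : ℝ) • (Qop * pd 0) - mx 0 * Egen l
def Cgen (l : ℝ) (i : Fin 3) : 𝔸 := (1/2 : ℝ) • (Qop * pd i.succ) + mx i.succ * Egen l
def Cfull (l : ℝ) : Fin 4 → 𝔸 := Fin.cons (C0gen l) (fun i => Cgen l i)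


/- Conformal null-plane basis (latin coordinate index `i ∈ {1,2,3}` is `Fin 3` index
`i-1`, so `K_1 = Kgen 0`, `J_1 = Jgen 0`, `K_2 = Kgen 1`, `J_2 = Jgen 1`, etc.). -/
def Hp (l : ℝ) : 𝔸 := (1/2 : ℝ) • (Ddil l + Kgen 0)
def Hm (l : ℝ) : 𝔸 := (1/2 : ℝ) • (Ddil l - Kgen 0)
def Tp : 𝔸 := (1/2 : ℝ) • (Pgen 0 + Pgen 1)
def Tm : 𝔸 := (1/2 : ℝ) • (Pgen 0 - Pgen 1)
def T2 : 𝔸 := (1/2 : ℝ) • (Pgen 2 - Pgen 3)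
def T3 : 𝔸 := (1/2 : ℝ) • (Pgen 2 + Pgen 3)
def B2 : 𝔸 := (1/2 : ℝ) • (Kgen 1 + Jgen 2 - Kgen 2 + Jgen 1)
def B3 : 𝔸 := (1/2 : ℝ) • (Kgen 1 + Jgen 2 + Kgen 2 - Jgen 1)
def A2 : 𝔸 := (1/2 : ℝ) • (Kgen 1 - Jgen 2 - Kgen 2 - Jgen 1)
def A3 : 𝔸 := (1/2 : ℝ) • (Kgen 1 - Jgen 2 + Kgen 2 + Jgen 1)
def Gp (l : ℝ) : 𝔸 := (1/2 : ℝ) • (C0gen l + Cgen l 0)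
def Gm (l : ℝ) : 𝔸 := (1/2 : ℝ) • (C0gen l - Cgen l 0)
def G2 (l : ℝ) : 𝔸 := (1/2 : ℝ) • (Cgen l 1 - Cgen l 2)
def G3 (l : ℝ) : 𝔸 := (1/2 : ℝ) • (Cgen l 1 + Cgen l 2)

open MvPolynomial

/-- The coefficients of the vector field `p ∂_ν`. -/
def coordField (ν : Fin 4) (p : MvPolynomial (Fin 4) ℝ) : Fin 4 → MvPolynomial (Fin 4) ℝ :=
  Pi.single ν p

/-- The vector field `Σ μ, f μ ∂_μ` with polynomial coefficients, as an operator. -/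
def vectorField (f : Fin 4 → MvPolynomial (Fin 4) ℝ) : 𝔸 := (mkDerivation ℝ f).toLinearMap

@[simp]
theorem vectorField_X (f : Fin 4 → MvPolynomial (Fin 4) ℝ) (i : Fin 4) :
    vectorField f (X i) = f i :=
  mkDerivation_X ℝ f i

@[simp]
theorem vectorField_one (f : Fin 4 → MvPolynomial (Fin 4) ℝ) : vectorField f 1 = 0 :=
  (mkDerivation ℝ f).map_one_eq_zero

theorem vectorField_add (f g : Fin 4 → MvPolynomial (Fin 4) ℝ) :
    vectorField (f + g) = vectorField f + vectorField g := by
  have h : mkDerivation ℝ (f + g) = mkDerivation ℝ f + mkDerivation ℝ g :=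
    derivation_ext fun i => by simp
  rw [vectorField, h]
  rfl

theorem vectorField_sub (f g : Fin 4 → MvPolynomial (Fin 4) ℝ) :
    vectorField (f - g) = vectorField f - vectorField g := by
  have h : mkDerivation ℝ (f - g) = mkDerivation ℝ f - mkDerivation ℝ g :=
    derivation_ext fun i => by simp
  rw [vectorField, h]
  rfl

theorem vectorField_neg (f : Fin 4 → MvPolynomial (Fin 4) ℝ) :
    vectorField (-f) = -vectorField f := by
  have h : mkDerivation ℝ (-f) = -mkDerivation ℝ f :=
    derivation_ext fun i => by simp
  rw [vectorField, h]
  rfl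

theorem vectorField_smul (c : ℝ) (f : Fin 4 → MvPolynomial (Fin 4) ℝ) :
    vectorField (c • f) = c • vectorField f := by
  have h : mkDerivation ℝ (c • f) = c • mkDerivation ℝ f :=
    derivation_ext fun i => by simp
  rw [vectorField, h]
  rfl

theorem vectorField_zero : vectorField 0 = 0 := by
  simpa using vectorField_smul 0 0

theorem lie_vectorField (f g : Fin 4 → MvPolynomial (Fin 4) ℝ) :
    ⁅vectorField f, vectorField g⁆ =
      vectorField fun i => vectorField f (g i) - vectorField g (f i) := by
  have h : ⁅mkDerivation ℝ f, mkDerivation ℝ g⁆ =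
      mkDerivation ℝ fun i => vectorField f (g i) - vectorField g (f i) := by
    refine derivation_ext fun i => ?_
    rw [Derivation.commutator_apply, mkDerivation_X, mkDerivation_X, mkDerivation_X]
    rfl
  exact congrArg Derivation.toLinearMap h

theorem mx_mul_pd (μ ν : Fin 4) : mx μ * pd ν = vectorField (coordField ν (X μ)) := by
  have h : (X μ : MvPolynomial (Fin 4) ℝ) • pderiv ν = mkDerivation ℝ (coordField ν (X μ)) := by
    refine derivation_ext fun i => ?_
    rw [Derivation.smul_apply, pderiv_X, mkDerivation_X]
    obtain rfl | hi := eq_or_ne i ν <;> simp [coordField, *]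
  exact congrArg Derivation.toLinearMap h

theorem pd_eq_vectorField (ν : Fin 4) : pd ν = vectorField (coordField ν 1) := by
  have h : pderiv ν = mkDerivation ℝ (coordField ν 1) := by
    refine derivation_ext fun i => ?_
    rw [pderiv_X, mkDerivation_X]
    obtain rfl | hi := eq_or_ne i ν <;> simp [coordField, *]
  exact congrArg Derivation.toLinearMap h

theorem Kgen_zero_eq_vectorField : Kgen 0 = vectorField ![-X 1, -X 0, 0, 0] := by
  have h : (![-X 1, -X 0, 0, 0] : Fin 4 → MvPolynomial (Fin 4) ℝ) =
      -coordField 0 (X 1) - coordField 1 (X 0) := by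
    ext1 i; fin_cases i <;> simp [coordField]
  rw [h, vectorField_sub, vectorField_neg, ← mx_mul_pd, ← mx_mul_pd]
  rfl

theorem Kgen_one_eq_vectorField : Kgen 1 = vectorField ![-X 2, 0, -X 0, 0] := by
  have h : (![-X 2, 0, -X 0, 0] : Fin 4 → MvPolynomial (Fin 4) ℝ) =
      -coordField 0 (X 2) - coordField 2 (X 0) := by
    ext1 i; fin_cases i <;> simp [coordField]
  rw [h, vectorField_sub, vectorField_neg, ← mx_mul_pd, ← mx_mul_pd]
  rfl

theorem Kgen_two_eq_vectorField : Kgen 2 = vectorField ![-X 3, 0, 0, -X 0] := by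
  have h : (![-X 3, 0, 0, -X 0] : Fin 4 → MvPolynomial (Fin 4) ℝ) =
      -coordField 0 (X 3) - coordField 3 (X 0) := by
    ext1 i; fin_cases i <;> simp [coordField]
  rw [h, vectorField_sub, vectorField_neg, ← mx_mul_pd, ← mx_mul_pd]
  rfl

theorem Jgen_zero_eq_vectorField : Jgen 0 = vectorField ![0, 0, X 3, -X 2] := by
  have h : (![0, 0, X 3, -X 2] : Fin 4 → MvPolynomial (Fin 4) ℝ) =
      coordField 2 (X 3) - coordField 3 (X 2) := by
    ext1 i; fin_cases i <;> simp [coordField]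
  rw [h, vectorField_sub, ← mx_mul_pd, ← mx_mul_pd]
  simp [Jgen, eps, Fin.sum_univ_three]
  norm_num
  module

theorem Jgen_one_eq_vectorField : Jgen 1 = vectorField ![0, -X 3, 0, X 1] := by
  have h : (![0, -X 3, 0, X 1] : Fin 4 → MvPolynomial (Fin 4) ℝ) =
      coordField 3 (X 1) - coordField 1 (X 3) := by
    ext1 i; fin_cases i <;> simp [coordField]
  rw [h, vectorField_sub, ← mx_mul_pd, ← mx_mul_pd]
  simp [Jgen, eps, Fin.sum_univ_three]
  norm_num
  module

theorem Jgen_two_eq_vectorField : Jgen 2 = vectorField ![0, X 2, -X 1, 0] := by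
  have h : (![0, X 2, -X 1, 0] : Fin 4 → MvPolynomial (Fin 4) ℝ) =
      coordField 1 (X 2) - coordField 2 (X 1) := by
    ext1 i; fin_cases i <;> simp [coordField]
  rw [h, vectorField_sub, ← mx_mul_pd, ← mx_mul_pd]
  simp [Jgen, eps, Fin.sum_univ_three]
  norm_num
  module

theorem Ddil_eq_vectorField (l : ℝ) : Ddil l = vectorField (-X) - l • (1 : 𝔸) := by
  have h : (X : Fin 4 → MvPolynomial (Fin 4) ℝ) = coordField 0 (X 0) + coordField 1 (X 1) +
      coordField 2 (X 2) + coordField 3 (X 3) := by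
    ext1 i; fin_cases i <;> simp [coordField]
  rw [h, Ddil, Fin.sum_univ_four]
  simp only [mx_mul_pd, vectorField_add, vectorField_neg]

theorem lie_sub_smul_one (U V : 𝔸) (c : ℝ) : ⁅U, V - c • (1 : 𝔸)⁆ = ⁅U, V⁆ := by
  simp [Ring.lie_def, mul_sub, sub_mul]

theorem sub_smul_one_lie (U V : 𝔸) (c : ℝ) : ⁅U - c • (1 : 𝔸), V⁆ = ⁅U, V⁆ := by
  simp [Ring.lie_def, mul_sub, sub_mul]

theorem Hp_eq_vectorField (l : ℝ) : Hp l =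
    vectorField ((1/2 : ℝ) • ![-X 0 - X 1, -X 1 - X 0, -X 2, -X 3]) - (l/2) • (1 : 𝔸) := by
  have h : (![-X 0 - X 1, -X 1 - X 0, -X 2, -X 3] : Fin 4 → MvPolynomial (Fin 4) ℝ) =
      -X + ![-X 1, -X 0, 0, 0] := by
    ext1 i; fin_cases i <;> simp <;> module
  rw [h, Hp, Ddil_eq_vectorField, Kgen_zero_eq_vectorField, vectorField_smul,
    vectorField_add]
  module

theorem Hm_eq_vectorField (l : ℝ) : Hm l =
    vectorField ((1/2 : ℝ) • ![-X 0 + X 1, -X 1 + X 0, -X 2, -X 3]) - (l/2) • (1 : 𝔸) := by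
  have h : (![-X 0 + X 1, -X 1 + X 0, -X 2, -X 3] : Fin 4 → MvPolynomial (Fin 4) ℝ) =
      -X - ![-X 1, -X 0, 0, 0] := by
    ext1 i; fin_cases i <;> simp
  rw [h, Hm, Ddil_eq_vectorField, Kgen_zero_eq_vectorField, vectorField_smul,
    vectorField_sub]
  module

theorem Tp_eq_vectorField : Tp = vectorField ((1/2 : ℝ) • ![1, 1, 0, 0]) := by
  have h : (![1, 1, 0, 0] : Fin 4 → MvPolynomial (Fin 4) ℝ) =
      coordField 0 1 + coordField 1 1 := by
    ext1 i; fin_cases i <;> simp [coordField]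
  rw [h, Tp, Pgen, Pgen, pd_eq_vectorField, pd_eq_vectorField, vectorField_smul,
    vectorField_add]

theorem Tm_eq_vectorField : Tm = vectorField ((1/2 : ℝ) • ![1, -1, 0, 0]) := by
  have h : (![1, -1, 0, 0] : Fin 4 → MvPolynomial (Fin 4) ℝ) =
      coordField 0 1 - coordField 1 1 := by
    ext1 i; fin_cases i <;> simp [coordField]
  rw [h, Tm, Pgen, Pgen, pd_eq_vectorField, pd_eq_vectorField, vectorField_smul,
    vectorField_sub]

theorem T2_eq_vectorField : T2 = vectorField ((1/2 : ℝ) • ![0, 0, 1, -1]) := by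
  have h : (![0, 0, 1, -1] : Fin 4 → MvPolynomial (Fin 4) ℝ) =
      coordField 2 1 - coordField 3 1 := by
    ext1 i; fin_cases i <;> simp [coordField]
  rw [h, T2, Pgen, Pgen, pd_eq_vectorField, pd_eq_vectorField, vectorField_smul,
    vectorField_sub]

theorem T3_eq_vectorField : T3 = vectorField ((1/2 : ℝ) • ![0, 0, 1, 1]) := by
  have h : (![0, 0, 1, 1] : Fin 4 → MvPolynomial (Fin 4) ℝ) =
      coordField 2 1 + coordField 3 1 := by
    ext1 i; fin_cases i <;> simp [coordField]
  rw [h, T3, Pgen, Pgen, pd_eq_vectorField, pd_eq_vectorField, vectorField_smul,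
    vectorField_add]

theorem B2_eq_vectorField : B2 = vectorField
    ((1/2 : ℝ) • ![X 3 - X 2, X 2 - X 3, -X 0 - X 1, X 0 + X 1]) := by
  simp only [B2, Kgen_one_eq_vectorField, Kgen_two_eq_vectorField, Jgen_one_eq_vectorField,
    Jgen_two_eq_vectorField, ← vectorField_smul, ← vectorField_add, ← vectorField_sub]
  refine congrArg vectorField (funext fun i => ?_)
  fin_cases i <;> simp <;> module

theorem B3_eq_vectorField : B3 = vectorField
    ((1/2 : ℝ) • ![-X 2 - X 3, X 2 + X 3, -X 0 - X 1, -X 0 - X 1]) := by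
  simp only [B3, Kgen_one_eq_vectorField, Kgen_two_eq_vectorField, Jgen_one_eq_vectorField,
    Jgen_two_eq_vectorField, ← vectorField_smul, ← vectorField_add, ← vectorField_sub]
  refine congrArg vectorField (funext fun i => ?_)
  fin_cases i <;> simp <;> module

theorem A2_eq_vectorField : A2 = vectorField
    ((1/2 : ℝ) • ![X 3 - X 2, X 3 - X 2, X 1 - X 0, X 0 - X 1]) := by
  simp only [A2, Kgen_one_eq_vectorField, Kgen_two_eq_vectorField, Jgen_one_eq_vectorField,
    Jgen_two_eq_vectorField, ← vectorField_smul, ← vectorField_sub]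
  refine congrArg vectorField (funext fun i => ?_)
  fin_cases i <;> simp <;> module

theorem A3_eq_vectorField : A3 = vectorField
    ((1/2 : ℝ) • ![-X 2 - X 3, -X 2 - X 3, X 1 - X 0, X 1 - X 0]) := by
  simp only [A3, Kgen_one_eq_vectorField, Kgen_two_eq_vectorField, Jgen_one_eq_vectorField,
    Jgen_two_eq_vectorField, ← vectorField_smul, ← vectorField_add, ← vectorField_sub]
  refine congrArg vectorField (funext fun i => ?_)
  fin_cases i <;> simp <;> module

/-- Together with the carrier relations, the operators `A_2, A_3, J_1` close the
Weyl--Poincaré subalgebra in the null-plane basis, with exactly the stated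
nonvanishing commutators; all remaining brackets vanish. -/
theorem weyl_poincare_null_plane_relations (l : ℝ) :
    -- carrier relations
    ⁅Hp l, Tp⁆ = Tp ∧
    ⁅Hp l, T2⁆ = (1/2 : ℝ) • T2 ∧ ⁅Hp l, T3⁆ = (1/2 : ℝ) • T3 ∧
    ⁅Hp l, B2⁆ = -((1/2 : ℝ) • B2) ∧ ⁅Hp l, B3⁆ = -((1/2 : ℝ) • B3) ∧
    ⁅B2, Tp⁆ = T2 ∧ ⁅B3, Tp⁆ = T3 ∧
    ⁅Hm l, Tm⁆ = Tm ∧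
    ⁅Hm l, T2⁆ = (1/2 : ℝ) • T2 ∧ ⁅Hm l, T3⁆ = (1/2 : ℝ) • T3 ∧
    ⁅Hm l, B2⁆ = (1/2 : ℝ) • B2 ∧ ⁅Hm l, B3⁆ = (1/2 : ℝ) • B3 ∧
    ⁅B2, T2⁆ = Tm ∧ ⁅B3, T3⁆ = Tm ∧
    -- additional nonvanishing relations
    ⁅Hp l, A2⁆ = (1/2 : ℝ) • A2 ∧ ⁅Hp l, A3⁆ = (1/2 : ℝ) • A3 ∧
    ⁅Hm l, A2⁆ = -((1/2 : ℝ) • A2) ∧ ⁅Hm l, A3⁆ = -((1/2 : ℝ) • A3) ∧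
    ⁅A2, T2⁆ = Tp ∧ ⁅A3, T3⁆ = Tp ∧
    ⁅A2, Tm⁆ = T2 ∧ ⁅A3, Tm⁆ = T3 ∧
    ⁅Jgen 0, A2⁆ = A3 ∧ ⁅Jgen 0, A3⁆ = -A2 ∧
    ⁅Jgen 0, B2⁆ = B3 ∧ ⁅Jgen 0, B3⁆ = -B2 ∧
    ⁅Jgen 0, T2⁆ = T3 ∧ ⁅Jgen 0, T3⁆ = -T2 ∧
    ⁅A2, B2⁆ = Hp l - Hm l ∧ ⁅A3, B3⁆ = Hp l - Hm l ∧
    ⁅A2, B3⁆ = -Jgen 0 ∧ ⁅A3, B2⁆ = Jgen 0 ∧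
    -- all other commutators among the eleven operators vanish
    ⁅A2, A3⁆ = 0 ∧ ⁅A2, Tp⁆ = 0 ∧ ⁅A3, Tp⁆ = 0 ∧
    ⁅A2, T3⁆ = 0 ∧ ⁅A3, T2⁆ = 0 ∧
    ⁅Jgen 0, Hp l⁆ = 0 ∧ ⁅Jgen 0, Hm l⁆ = 0 ∧
    ⁅Jgen 0, Tp⁆ = 0 ∧ ⁅Jgen 0, Tm⁆ = 0 ∧
    ⁅Hp l, Hm l⁆ = 0 ∧ ⁅Hp l, Tm⁆ = 0 ∧ ⁅Hm l, Tp⁆ = 0 ∧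
    ⁅B2, B3⁆ = 0 ∧ ⁅B2, T3⁆ = 0 ∧ ⁅B3, T2⁆ = 0 ∧
    ⁅B2, Tm⁆ = 0 ∧ ⁅B3, Tm⁆ = 0 ∧
    ⁅Tp, Tm⁆ = 0 ∧ ⁅Tp, T2⁆ = 0 ∧ ⁅Tp, T3⁆ = 0 ∧
    ⁅Tm, T2⁆ = 0 ∧ ⁅Tm, T3⁆ = 0 ∧ ⁅T2, T3⁆ = 0 := by
  have hH : Hp l - Hm l = Kgen 0 := by
    rw [Hp, Hm]
    module
  rw [hH]
  simp only [Hp_eq_vectorField, Hm_eq_vectorField, Tp_eq_vectorField, Tm_eq_vectorField,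
    T2_eq_vectorField, T3_eq_vectorField, B2_eq_vectorField, B3_eq_vectorField,
    A2_eq_vectorField, A3_eq_vectorField, Jgen_zero_eq_vectorField, Kgen_zero_eq_vectorField,
    sub_smul_one_lie, lie_sub_smul_one, lie_vectorField, ← vectorField_smul, ← vectorField_neg,
    ← vectorField_zero]
  and_intros
  all_goals
    refine congrArg vectorField (funext fun i => ?_)
    fin_cases i <;> simp <;> module
end
end

section
/- The conformal transformations G_+, G_−, G_2, G_3 satisfy, for a,b ∈ {2,3}, the commutation relations [H_+,G_−] = −G_−, [H_+,G_a] = −(1/2)G_a, [G_+,T_−] = −H_−, [H_−,G_+] = −G_+, [H_−,G_a] = −(1/2)G_a, [G_−,T_+] = −H_+, [G_+,T_a] = −(1/2)A_a, [G_+,B_a] = −G_a, [G_a,T_+] = (1/2)A_a, [G_−,T_a] = −(1/2)B_a, [G_−,A_a] = −G_a, [G_a,T_−] = (1/2)B_a, [G_a,A_a] = −G_+, [G_a,B_a] = −G_−, [J_1,G_a] = Σ_b ε_{1ab} G_b, [G_a,T_b] = (1/2)δ_ab(H_+ + H_−) + (1/2)ε_{1ab} J_1, and moreover all commutators among {G_+,G_−,G_2,G_3}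 vanish, as do [H_+,G_+], [H_−,G_−], [J_1,G_+] and [J_1,G_−]. -/
noncomputable section

/-- The first-order differential operator `∑ μ, v μ * ∂_μ + g` on polynomials. -/
def firstOrder (v : Fin 4 → MvPolynomial (Fin 4) ℝ) (g : MvPolynomial (Fin 4) ℝ) : 𝔸 :=
  (MvPolynomial.mkDerivation ℝ v).toLinearMap + LinearMap.mulLeft ℝ g

theorem firstOrder_apply (v : Fin 4 → MvPolynomial (Fin 4) ℝ) (g p : MvPolynomial (Fin 4) ℝ) :
    firstOrder v g p = MvPolynomial.mkDerivation ℝ v p + g * p := rfl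

theorem mkDerivation_apply_eq_sum_pderiv (v : Fin 4 → MvPolynomial (Fin 4) ℝ)
    (p : MvPolynomial (Fin 4) ℝ) :
    MvPolynomial.mkDerivation ℝ v p = ∑ μ, v μ * MvPolynomial.pderiv μ p := by
  have h : MvPolynomial.mkDerivation ℝ v = ∑ μ, v μ • MvPolynomial.pderiv μ := by
    refine MvPolynomial.derivation_ext fun i => ?_
    rw [MvPolynomial.mkDerivation_X, ← Derivation.coeFnAddMonoidHom_apply, map_sum,
      Finset.sum_apply, Finset.sum_eq_single i
        (fun j _ hj => by simp [MvPolynomial.pderiv_X_of_ne hj.symm]) (by simp)]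
    simp
  rw [h, ← Derivation.coeFnAddMonoidHom_apply, map_sum, Finset.sum_apply]
  rfl

theorem lie_mkDerivation (v w : Fin 4 → MvPolynomial (Fin 4) ℝ) :
    ⁅MvPolynomial.mkDerivation ℝ v, MvPolynomial.mkDerivation ℝ w⁆ =
      MvPolynomial.mkDerivation ℝ fun ν =>
        MvPolynomial.mkDerivation ℝ v (w ν) - MvPolynomial.mkDerivation ℝ w (v ν) :=
  MvPolynomial.derivation_ext fun ν => by
    simp [Derivation.commutator_apply, MvPolynomial.mkDerivation_X]

theorem lie_firstOrder (v w : Fin 4 → MvPolynomial (Fin 4) ℝ) (g h : MvPolynomial (Fin 4) ℝ) :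
    ⁅firstOrder v g, firstOrder w h⁆ =
      firstOrder
        (fun ν => MvPolynomial.mkDerivation ℝ v (w ν) - MvPolynomial.mkDerivation ℝ w (v ν))
        (MvPolynomial.mkDerivation ℝ v h - MvPolynomial.mkDerivation ℝ w g) := by
  refine LinearMap.ext fun p => ?_
  rw [firstOrder_apply, ← lie_mkDerivation, Derivation.commutator_apply]
  simp only [Ring.lie_def, LinearMap.sub_apply, Module.End.mul_apply, firstOrder_apply, map_add,
    Derivation.leibniz, smul_eq_mul]
  ring

theorem Pgen_eq_firstOrder (μ : Fin 4) : Pgen μ = firstOrder (Pi.single μ 1) 0 := by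
  refine LinearMap.ext fun p => ?_
  simp [Pgen, pd, firstOrder_apply, mkDerivation_apply_eq_sum_pderiv, Pi.single_apply]

theorem Ddil_eq_firstOrder (l : ℝ) :
    Ddil l = firstOrder (fun μ => -MvPolynomial.X μ) (-MvPolynomial.C l) := by
  refine LinearMap.ext fun p => ?_
  simp [Ddil, pd, mx, firstOrder_apply, mkDerivation_apply_eq_sum_pderiv,
    MvPolynomial.smul_eq_C_mul, sub_eq_add_neg]

theorem Kgen_eq_firstOrder (i : Fin 3) :
    Kgen i = firstOrder
      (Pi.single (M := fun _ => MvPolynomial (Fin 4) ℝ) 0 (-MvPolynomial.X i.succ) +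
        Pi.single i.succ (-MvPolynomial.X 0)) 0 := by
  refine LinearMap.ext fun p => ?_
  simp [Kgen, pd, mx, firstOrder_apply, mkDerivation_apply_eq_sum_pderiv, Pi.single_apply,
    add_mul, Finset.sum_add_distrib, sub_eq_add_neg]

theorem Jgen_eq_firstOrder (i : Fin 3) :
    Jgen i = firstOrder
      (∑ j : Fin 3, ∑ k : Fin 3,
        Pi.single j.succ (MvPolynomial.C (eps i j k) * MvPolynomial.X k.succ)) 0 := by
  refine LinearMap.ext fun p => ?_
  simp [Jgen, pd, mx, firstOrder_apply, mkDerivation_apply_eq_sum_pderiv, Fin.sum_univ_succ,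
    MvPolynomial.smul_eq_C_mul, Pi.single_apply]
  ring

/-- The Minkowski square `(x⁰)² - (x¹)² - (x²)² - (x³)²` as a polynomial. -/
def minkowskiSq : MvPolynomial (Fin 4) ℝ :=
  MvPolynomial.X 0 * MvPolynomial.X 0 - MvPolynomial.X 1 * MvPolynomial.X 1 -
    MvPolynomial.X 2 * MvPolynomial.X 2 - MvPolynomial.X 3 * MvPolynomial.X 3

theorem C0gen_eq_firstOrder (l : ℝ) :
    C0gen l = firstOrder
      (Pi.single 0 (MvPolynomial.C (1 / 2) * minkowskiSq) -
        fun μ => MvPolynomial.X 0 * MvPolynomial.X μ)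
      (-(MvPolynomial.X 0 * MvPolynomial.C l)) := by
  refine LinearMap.ext fun p => ?_
  simp only [C0gen, Qop, Egen, pd, mx, minkowskiSq, firstOrder_apply,
    mkDerivation_apply_eq_sum_pderiv, Fin.sum_univ_four, MvPolynomial.smul_eq_C_mul,
    LinearMap.add_apply, LinearMap.sub_apply, LinearMap.smul_apply, Module.End.mul_apply,
    Module.End.one_apply, LinearMap.mulLeft_apply, Derivation.coeFn_coe, Pi.sub_apply,
    Pi.single_apply]
  simp
  ring

theorem Cgen_eq_firstOrder (l : ℝ) (i : Fin 3) :
    Cgen l i = firstOrder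
      (Pi.single i.succ (MvPolynomial.C (1 / 2) * minkowskiSq) +
        fun μ => MvPolynomial.X i.succ * MvPolynomial.X μ)
      (MvPolynomial.X i.succ * MvPolynomial.C l) := by
  refine LinearMap.ext fun p => ?_
  simp only [Cgen, Qop, Egen, pd, mx, minkowskiSq, firstOrder_apply,
    mkDerivation_apply_eq_sum_pderiv, MvPolynomial.smul_eq_C_mul,
    LinearMap.add_apply, LinearMap.sub_apply, LinearMap.smul_apply, Module.End.mul_apply,
    Module.End.one_apply, LinearMap.mulLeft_apply, Derivation.coeFn_coe, Pi.add_apply,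
    Pi.single_apply, add_mul, Finset.sum_add_distrib, LinearMap.sum_apply]
  simp [mul_add, Finset.mul_sum, mul_assoc]
  ring

theorem lie_Ddil_C0gen (l : ℝ) :
    ⁅Ddil l, C0gen l⁆ = -C0gen l := by
  simp only [Ddil_eq_firstOrder, C0gen_eq_firstOrder, lie_firstOrder]
  refine LinearMap.ext fun p => MvPolynomial.funext fun x => ?_
  simp [firstOrder_apply, mkDerivation_apply_eq_sum_pderiv, Fin.sum_univ_four, minkowskiSq,
    MvPolynomial.pderiv_X, Pi.single_apply]
  ring

theorem lie_Ddil_Cgen (l : ℝ) (i : Fin 3) :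
    ⁅Ddil l, Cgen l i⁆ = -Cgen l i := by
  simp only [Ddil_eq_firstOrder, Cgen_eq_firstOrder, lie_firstOrder]
  refine LinearMap.ext fun p => MvPolynomial.funext fun x => ?_
  fin_cases i <;>
    simp [firstOrder_apply, mkDerivation_apply_eq_sum_pderiv, Fin.sum_univ_four, minkowskiSq,
      MvPolynomial.pderiv_X, Pi.single_apply] <;>
    ring

theorem lie_C0gen_Pgen_zero (l : ℝ) :
    ⁅C0gen l, Pgen 0⁆ = -Ddil l := by
  simp only [Ddil_eq_firstOrder, Pgen_eq_firstOrder, C0gen_eq_firstOrder, lie_firstOrder]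
  refine LinearMap.ext fun p => MvPolynomial.funext fun x => ?_
  simp [firstOrder_apply, mkDerivation_apply_eq_sum_pderiv, Fin.sum_univ_four, minkowskiSq,
    MvPolynomial.pderiv_X, Pi.single_apply]
  ring

theorem lie_C0gen_Pgen_succ (l : ℝ) (i : Fin 3) :
    ⁅C0gen l, Pgen i.succ⁆ = -Kgen i := by
  simp only [Kgen_eq_firstOrder, Pgen_eq_firstOrder, C0gen_eq_firstOrder, lie_firstOrder]
  refine LinearMap.ext fun p => MvPolynomial.funext fun x => ?_
  fin_cases i <;>
    simp [firstOrder_apply, mkDerivation_apply_eq_sum_pderiv, Fin.sum_univ_four, minkowskiSq,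
      MvPolynomial.pderiv_X, Pi.single_apply] <;>
    ring

theorem lie_Cgen_Pgen_zero (l : ℝ) (i : Fin 3) :
    ⁅Cgen l i, Pgen 0⁆ = Kgen i := by
  simp only [Kgen_eq_firstOrder, Pgen_eq_firstOrder, Cgen_eq_firstOrder, lie_firstOrder]
  refine LinearMap.ext fun p => MvPolynomial.funext fun x => ?_
  fin_cases i <;>
    simp [firstOrder_apply, mkDerivation_apply_eq_sum_pderiv, Fin.sum_univ_four, minkowskiSq,
      MvPolynomial.pderiv_X, Pi.single_apply, -mul_eq_mul_right_iff] <;>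
    ring

theorem lie_Cgen_Pgen_succ (l : ℝ) (i j : Fin 3) :
    ⁅Cgen l i, Pgen j.succ⁆ =
      (∑ k, eps i j k • Jgen k) + if i = j then Ddil l else 0 := by
  simp only [Ddil_eq_firstOrder, Jgen_eq_firstOrder, Pgen_eq_firstOrder, Cgen_eq_firstOrder,
    lie_firstOrder]
  refine LinearMap.ext fun p => MvPolynomial.funext fun x => ?_
  fin_cases i <;> fin_cases j <;>
    simp [firstOrder_apply, mkDerivation_apply_eq_sum_pderiv, Fin.sum_univ_four, minkowskiSq,
      MvPolynomial.pderiv_X, Pi.single_apply, Fin.sum_univ_three, eps] <;>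
    ring

theorem lie_Kgen_C0gen (l : ℝ) (i : Fin 3) :
    ⁅Kgen i, C0gen l⁆ = Cgen l i := by
  simp only [Kgen_eq_firstOrder, C0gen_eq_firstOrder, Cgen_eq_firstOrder, lie_firstOrder]
  refine LinearMap.ext fun p => MvPolynomial.funext fun x => ?_
  fin_cases i <;>
    simp [firstOrder_apply, mkDerivation_apply_eq_sum_pderiv, Fin.sum_univ_four, minkowskiSq,
      MvPolynomial.pderiv_X, Pi.single_apply] <;>
    ring

theorem lie_Kgen_Cgen (l : ℝ) (i j : Fin 3) :
    ⁅Kgen i, Cgen l j⁆ = if i = j then C0gen l else 0 := by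
  simp only [Kgen_eq_firstOrder, C0gen_eq_firstOrder, Cgen_eq_firstOrder, lie_firstOrder]
  refine LinearMap.ext fun p => MvPolynomial.funext fun x => ?_
  fin_cases i <;> fin_cases j <;>
    simp [firstOrder_apply, mkDerivation_apply_eq_sum_pderiv, Fin.sum_univ_four, minkowskiSq,
      MvPolynomial.pderiv_X, Pi.single_apply] <;>
    ring

theorem lie_Jgen_C0gen (l : ℝ) (i : Fin 3) :
    ⁅Jgen i, C0gen l⁆ = 0 := by
  simp only [Jgen_eq_firstOrder, C0gen_eq_firstOrder, lie_firstOrder]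
  refine LinearMap.ext fun p => MvPolynomial.funext fun x => ?_
  fin_cases i <;>
    simp [firstOrder_apply, mkDerivation_apply_eq_sum_pderiv, Fin.sum_univ_four, minkowskiSq,
      MvPolynomial.pderiv_X, Pi.single_apply, Fin.sum_univ_three, eps] <;>
    ring

theorem lie_Jgen_Cgen (l : ℝ) (i j : Fin 3) :
    ⁅Jgen i, Cgen l j⁆ = ∑ k, eps i j k • Cgen l k := by
  simp only [Jgen_eq_firstOrder, Cgen_eq_firstOrder, lie_firstOrder]
  refine LinearMap.ext fun p => MvPolynomial.funext fun x => ?_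
  fin_cases i <;> fin_cases j <;>
    simp [firstOrder_apply, mkDerivation_apply_eq_sum_pderiv, Fin.sum_univ_four, minkowskiSq,
      MvPolynomial.pderiv_X, Pi.single_apply, Fin.sum_univ_three, eps] <;>
    ring

theorem lie_C0gen_Cgen (l : ℝ) (i : Fin 3) :
    ⁅C0gen l, Cgen l i⁆ = 0 := by
  simp only [C0gen_eq_firstOrder, Cgen_eq_firstOrder, lie_firstOrder]
  refine LinearMap.ext fun p => MvPolynomial.funext fun x => ?_
  fin_cases i <;>
    simp [firstOrder_apply, mkDerivation_apply_eq_sum_pderiv, Fin.sum_univ_four, minkowskiSq,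
      MvPolynomial.pderiv_X, Pi.single_apply] <;>
    ring

theorem lie_Cgen_Cgen (l : ℝ) (i j : Fin 3) :
    ⁅Cgen l i, Cgen l j⁆ = 0 := by
  simp only [Cgen_eq_firstOrder, lie_firstOrder]
  refine LinearMap.ext fun p => MvPolynomial.funext fun x => ?_
  fin_cases i <;> fin_cases j <;>
    simp [firstOrder_apply, mkDerivation_apply_eq_sum_pderiv, Fin.sum_univ_four, minkowskiSq,
      MvPolynomial.pderiv_X, Pi.single_apply] <;>
    ring

/-- Commutation relations of the null-plane conformal transformations
`G_+, G_−, G_2, G_3` with the Weyl--Poincaré null-plane generators. -/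
theorem conformal_transformation_relations (l : ℝ) :
    ⁅Hp l, Gm l⁆ = -Gm l ∧
    ⁅Hp l, G2 l⁆ = -((1/2 : ℝ) • G2 l) ∧ ⁅Hp l, G3 l⁆ = -((1/2 : ℝ) • G3 l) ∧
    ⁅Gp l, Tm⁆ = -Hm l ∧
    ⁅Hm l, Gp l⁆ = -Gp l ∧
    ⁅Hm l, G2 l⁆ = -((1/2 : ℝ) • G2 l) ∧ ⁅Hm l, G3 l⁆ = -((1/2 : ℝ) • G3 l) ∧
    ⁅Gm l, Tp⁆ = -Hp l ∧
    ⁅Gp l, T2⁆ = -((1/2 : ℝ) • A2) ∧ ⁅Gp l, T3⁆ = -((1/2 : ℝ) • A3) ∧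
    ⁅Gp l, B2⁆ = -G2 l ∧ ⁅Gp l, B3⁆ = -G3 l ∧
    ⁅G2 l, Tp⁆ = (1/2 : ℝ) • A2 ∧ ⁅G3 l, Tp⁆ = (1/2 : ℝ) • A3 ∧
    ⁅Gm l, T2⁆ = -((1/2 : ℝ) • B2) ∧ ⁅Gm l, T3⁆ = -((1/2 : ℝ) • B3) ∧
    ⁅Gm l, A2⁆ = -G2 l ∧ ⁅Gm l, A3⁆ = -G3 l ∧
    ⁅G2 l, Tm⁆ = (1/2 : ℝ) • B2 ∧ ⁅G3 l, Tm⁆ = (1/2 : ℝ) • B3 ∧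
    ⁅G2 l, A2⁆ = -Gp l ∧ ⁅G3 l, A3⁆ = -Gp l ∧
    ⁅G2 l, B2⁆ = -Gm l ∧ ⁅G3 l, B3⁆ = -Gm l ∧
    ⁅Jgen 0, G2 l⁆ = G3 l ∧ ⁅Jgen 0, G3 l⁆ = -G2 l ∧
    ⁅G2 l, T2⁆ = (1/2 : ℝ) • (Hp l + Hm l) ∧ ⁅G3 l, T3⁆ = (1/2 : ℝ) • (Hp l + Hm l) ∧
    ⁅G2 l, T3⁆ = (1/2 : ℝ) • Jgen 0 ∧ ⁅G3 l, T2⁆ = -((1/2 : ℝ) • Jgen 0) ∧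
    -- vanishing brackets
    ⁅Gp l, Gm l⁆ = 0 ∧ ⁅Gp l, G2 l⁆ = 0 ∧ ⁅Gp l, G3 l⁆ = 0 ∧
    ⁅Gm l, G2 l⁆ = 0 ∧ ⁅Gm l, G3 l⁆ = 0 ∧ ⁅G2 l, G3 l⁆ = 0 ∧
    ⁅Hp l, Gp l⁆ = 0 ∧ ⁅Hm l, Gm l⁆ = 0 ∧
    ⁅Jgen 0, Gp l⁆ = 0 ∧ ⁅Jgen 0, Gm l⁆ = 0 := by
  have hP : Pgen 1 = Pgen (Fin.succ 0) ∧ Pgen 2 = Pgen (Fin.succ 1) ∧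
      Pgen 3 = Pgen (Fin.succ 2) :=
    ⟨rfl, rfl, rfl⟩
  have add_bracket (a b c : 𝔸) : ⁅a + b, c⁆ = ⁅a, c⁆ + ⁅b, c⁆ := by
    simp only [Ring.lie_def, add_mul, mul_add]; abel
  have bracket_add (a b c : 𝔸) : ⁅a, b + c⁆ = ⁅a, b⁆ + ⁅a, c⁆ := by
    simp only [Ring.lie_def, add_mul, mul_add]; abel
  have sub_bracket (a b c : 𝔸) : ⁅a - b, c⁆ = ⁅a, c⁆ - ⁅b, c⁆ := by
    simp only [Ring.lie_def, sub_mul, mul_sub]; abel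
  have bracket_sub (a b c : 𝔸) : ⁅a, b - c⁆ = ⁅a, b⁆ - ⁅a, c⁆ := by
    simp only [Ring.lie_def, sub_mul, mul_sub]; abel
  have smul_bracket (r : ℝ) (a b : 𝔸) : ⁅r • a, b⁆ = r • ⁅a, b⁆ := by
    simp only [Ring.lie_def, smul_mul_assoc, mul_smul_comm, smul_sub]
  have bracket_smul (r : ℝ) (a b : 𝔸) : ⁅a, r • b⁆ = r • ⁅a, b⁆ := by
    simp only [Ring.lie_def, smul_mul_assoc, mul_smul_comm, smul_sub]
  have bracket_skew (a b : 𝔸) : ⁅a, b⁆ = -⁅b, a⁆ := by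
    simp only [Ring.lie_def, neg_sub]
  have bracket_self : ⁅C0gen l, C0gen l⁆ = 0 := sub_self _
  have hKC0 (i : Fin 3) : ⁅C0gen l, Kgen i⁆ = -Cgen l i := by
    rw [bracket_skew, lie_Kgen_C0gen]
  have hKC (i j : Fin 3) : ⁅Cgen l j, Kgen i⁆ = -if i = j then C0gen l else 0 := by
    rw [bracket_skew, lie_Kgen_Cgen]
  have hJC0 (i : Fin 3) : ⁅C0gen l, Jgen i⁆ = 0 := by
    rw [bracket_skew, lie_Jgen_C0gen, neg_zero]
  have hJC (i j : Fin 3) : ⁅Cgen l j, Jgen i⁆ = -∑ k, eps i j k • Cgen l k := by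
    rw [bracket_skew, lie_Jgen_Cgen]
  have hCC0 (i : Fin 3) : ⁅Cgen l i, C0gen l⁆ = 0 := by
    rw [bracket_skew, lie_C0gen_Cgen, neg_zero]
  refine ⟨?_, ?_, ?_, ?_, ?_, ?_, ?_, ?_, ?_, ?_, ?_, ?_, ?_, ?_, ?_, ?_, ?_, ?_, ?_, ?_,
    ?_, ?_, ?_, ?_, ?_, ?_, ?_, ?_, ?_, ?_, ?_, ?_, ?_, ?_, ?_, ?_, ?_, ?_, ?_, ?_⟩ <;>
  · simp only [Hp, Hm, Tp, Tm, T2, T3, A2, A3, B2, B3, Gp, Gm, G2, G3, hP, bracket_smul,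
      smul_bracket, bracket_add, add_bracket, bracket_sub, sub_bracket, bracket_self,
      lie_Ddil_C0gen, lie_Ddil_Cgen,
      lie_C0gen_Pgen_zero, lie_C0gen_Pgen_succ, lie_Cgen_Pgen_zero, lie_Cgen_Pgen_succ,
      lie_Kgen_C0gen, lie_Kgen_Cgen, lie_Jgen_C0gen, lie_Jgen_Cgen, lie_C0gen_Cgen,
      lie_Cgen_Cgen, hKC0, hKC, hJC0, hJC, hCC0]
    simp [Fin.sum_univ_three, eps]
    try module
end
end

section
/- The element r := z[(D⊗P_0 − P_0⊗D) + (K_1⊗P_1 − P_1⊗K_1) + (K_2⊗P_2 − P_2⊗K_2) + (K_3⊗P_3 − P_3⊗K_3) + (J_3⊗P_2 − P_2⊗J_3) − (J_2⊗P_3 − P_3⊗J_2)] ∈ A ⊗ A satisfies the classical Yang–Baxter equation: writing r = Σ_s a_s ⊗ b_s and setting r_12 := Σ_s a_s⊗b_s⊗1, r_13 := Σ_s a_s⊗1⊗b_s, r_23 := Σ_s 1⊗a_s⊗b_s in A ⊗ A ⊗ A, one has [r_12, r_13] + [r_12, r_23] + [r_13, r_23] = 0, for every z ∈ ℝ and every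 conformal weight ℓ ∈ ℝ. -/
noncomputable section

open TensorProduct

noncomputable instance : Ring (𝔸 ⊗[ℝ] (𝔸 ⊗[ℝ] 𝔸)) :=
  Algebra.TensorProduct.instRing (R := ℝ) (A := 𝔸) (B := 𝔸 ⊗[ℝ] 𝔸)

/-- `r_12 : a ⊗ b ↦ a ⊗ b ⊗ 1`. -/
def ι12 : 𝔸 ⊗[ℝ] 𝔸 →ₗ[ℝ] 𝔸 ⊗[ℝ] (𝔸 ⊗[ℝ] 𝔸) :=
  TensorProduct.map LinearMap.id
    (Algebra.TensorProduct.includeLeft (R := ℝ) (A := 𝔸) (B := 𝔸)).toLinearMap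

/-- `r_13 : a ⊗ b ↦ a ⊗ 1 ⊗ b`. -/
def ι13 : 𝔸 ⊗[ℝ] 𝔸 →ₗ[ℝ] 𝔸 ⊗[ℝ] (𝔸 ⊗[ℝ] 𝔸) :=
  TensorProduct.map LinearMap.id
    (Algebra.TensorProduct.includeRight (R := ℝ) (A := 𝔸) (B := 𝔸)).toLinearMap

/-- `r_23 : a ⊗ b ↦ 1 ⊗ a ⊗ b`. -/
def ι23 : 𝔸 ⊗[ℝ] 𝔸 →ₗ[ℝ] 𝔸 ⊗[ℝ] (𝔸 ⊗[ℝ] 𝔸) :=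
  (Algebra.TensorProduct.includeRight (R := ℝ) (A := 𝔸) (B := 𝔸 ⊗[ℝ] 𝔸)).toLinearMap

/-- The classical r-matrix of the twisted conformal algebra `U_z(so(4,2))`. -/
def rmat (z l : ℝ) : 𝔸 ⊗[ℝ] 𝔸 :=
  z • ((Ddil l ⊗ₜ[ℝ] Pgen 0 - Pgen 0 ⊗ₜ[ℝ] Ddil l) +
       (Kgen 0 ⊗ₜ[ℝ] Pgen 1 - Pgen 1 ⊗ₜ[ℝ] Kgen 0) +
       (Kgen 1 ⊗ₜ[ℝ] Pgen 2 - Pgen 2 ⊗ₜ[ℝ] Kgen 1) +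
       (Kgen 2 ⊗ₜ[ℝ] Pgen 3 - Pgen 3 ⊗ₜ[ℝ] Kgen 2) +
       (Jgen 2 ⊗ₜ[ℝ] Pgen 2 - Pgen 2 ⊗ₜ[ℝ] Jgen 2) -
       (Jgen 1 ⊗ₜ[ℝ] Pgen 3 - Pgen 3 ⊗ₜ[ℝ] Jgen 1))

section YangBaxter

attribute [local instance] LieRing.ofAssociativeRing

variable {R B ι : Type*} [CommRing R] [Ring B] [Algebra R B] [Fintype ι]

/-- A skew tensor `∑ μ, (a μ ⊗ p μ - p μ ⊗ a μ)` with commuting `p μ` solves the classical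
Yang--Baxter equation when the structure constants satisfy the quasi-Frobenius condition. -/
theorem classicalYangBaxter_of_quasiFrobenius (a p : ι → B) (c : ι → ι → ι → R)
    (hpp : ∀ μ ν, ⁅p μ, p ν⁆ = 0)
    (hap : ∀ μ ν, ⁅a μ, p ν⁆ = ∑ ρ, c μ ν ρ • p ρ)
    (haa : ∀ μ ν, ⁅a μ, a ν⁆ = ∑ ρ, (c ν ρ μ - c μ ρ ν) • a ρ)
    (r₁₂ r₁₃ r₂₃ : B ⊗[R] (B ⊗[R] B))
    (h₁₂ : r₁₂ = ∑ μ, (a μ ⊗ₜ[R] (p μ ⊗ₜ[R] 1) - p μ ⊗ₜ[R] (a μ ⊗ₜ[R] 1)))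
    (h₁₃ : r₁₃ = ∑ μ, (a μ ⊗ₜ[R] (1 ⊗ₜ[R] p μ) - p μ ⊗ₜ[R] (1 ⊗ₜ[R] a μ)))
    (h₂₃ : r₂₃ = ∑ μ, (1 ⊗ₜ[R] (a μ ⊗ₜ[R] p μ) - 1 ⊗ₜ[R] (p μ ⊗ₜ[R] a μ))) :
    ⁅r₁₂, r₁₃⁆ + ⁅r₁₂, r₂₃⁆ + ⁅r₁₃, r₂₃⁆ = 0 := by
  have hpa : ∀ μ ν, ⁅p μ, a ν⁆ = -∑ ρ, c ν μ ρ • p ρ := fun μ ν => by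
    rw [← lie_skew, hap]
  have l₁ : ∀ x y u v : B, ⁅x ⊗ₜ[R] (u ⊗ₜ[R] (1 : B)), y ⊗ₜ[R] ((1 : B) ⊗ₜ[R] v)⁆
      = ⁅x, y⁆ ⊗ₜ[R] (u ⊗ₜ[R] v) := fun x y u v => by
    simp [Ring.lie_def, TensorProduct.sub_tmul]
  have l₂ : ∀ x y u v : B, ⁅x ⊗ₜ[R] (u ⊗ₜ[R] (1 : B)), (1 : B) ⊗ₜ[R] (y ⊗ₜ[R] v)⁆
      = x ⊗ₜ[R] (⁅u, y⁆ ⊗ₜ[R] v) := fun x y u v => by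
    simp [Ring.lie_def, TensorProduct.sub_tmul, TensorProduct.tmul_sub]
  have l₃ : ∀ x y u v : B, ⁅x ⊗ₜ[R] ((1 : B) ⊗ₜ[R] u), (1 : B) ⊗ₜ[R] (y ⊗ₜ[R] v)⁆
      = x ⊗ₜ[R] (y ⊗ₜ[R] ⁅u, v⁆) := fun x y u v => by
    simp [Ring.lie_def, TensorProduct.tmul_sub]
  have s₂₃ : ∀ f : ι → ι → ι → B ⊗[R] (B ⊗[R] B),
      ∑ μ, ∑ ν, ∑ ρ, f μ ν ρ = ∑ μ, ∑ ν, ∑ ρ, f μ ρ ν := fun f =>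
    Finset.sum_congr rfl fun _ _ => Finset.sum_comm
  have s₁₂ : ∀ f : ι → ι → ι → B ⊗[R] (B ⊗[R] B),
      ∑ μ, ∑ ν, ∑ ρ, f μ ν ρ = ∑ μ, ∑ ν, ∑ ρ, f ν μ ρ := fun f => Finset.sum_comm
  have s₁₃ : ∀ f : ι → ι → ι → B ⊗[R] (B ⊗[R] B),
      ∑ μ, ∑ ν, ∑ ρ, f μ ν ρ = ∑ μ, ∑ ν, ∑ ρ, f ρ ν μ := fun f => by
    rw [s₁₂, s₂₃, s₁₂]
  have sc : ∀ f : ι → ι → ι → B ⊗[R] (B ⊗[R] B),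
      ∑ μ, ∑ ν, ∑ ρ, f μ ν ρ = ∑ μ, ∑ ν, ∑ ρ, f ν ρ μ := fun f => by
    rw [s₂₃, s₁₂]
  subst h₁₂ h₁₃ h₂₃
  simp only [sum_lie_sum, lie_sub, sub_lie, l₁, l₂, l₃, hpp, hap, haa, hpa,
    TensorProduct.zero_tmul, TensorProduct.tmul_zero, TensorProduct.neg_tmul,
    TensorProduct.tmul_neg, TensorProduct.sum_tmul, TensorProduct.tmul_sum,
    ← TensorProduct.smul_tmul', TensorProduct.tmul_smul, sub_smul,
    TensorProduct.sub_tmul, TensorProduct.tmul_sub,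
    Finset.sum_sub_distrib, Finset.sum_neg_distrib, Finset.sum_const_zero]
  have e₁ := s₁₃ fun μ ν ρ => c ν ρ μ • a ρ ⊗ₜ[R] (p μ ⊗ₜ[R] p ν)
  have e₂ := sc fun μ ν ρ => c μ ρ ν • a ρ ⊗ₜ[R] (p μ ⊗ₜ[R] p ν)
  have e₃ := s₁₃ fun μ ν ρ => c ν μ ρ • p ρ ⊗ₜ[R] (a μ ⊗ₜ[R] p ν)
  have e₄ := s₂₃ fun μ ν ρ => c μ ρ ν • p μ ⊗ₜ[R] (a ρ ⊗ₜ[R] p ν)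
  have e₅ := s₂₃ fun μ ν ρ => c μ ν ρ • p μ ⊗ₜ[R] (p ρ ⊗ₜ[R] a ν)
  have e₆ := sc fun μ ν ρ => c μ ν ρ • p ρ ⊗ₜ[R] (p μ ⊗ₜ[R] a ν)
  rw [e₁, e₂, e₃, e₄, e₅, e₆]
  abel

end YangBaxter

section ConformalCommutators

attribute [local instance] LieRing.ofAssociativeRing

theorem pd_lie_pd (i j : Fin 4) : ⁅pd i, pd j⁆ = 0 := by
  have h : ⁅MvPolynomial.pderiv (R := ℝ) i, MvPolynomial.pderiv (R := ℝ) j⁆ = 0 := by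
    apply MvPolynomial.derivation_ext
    intro k
    simp [Derivation.commutator_apply, MvPolynomial.pderiv_X, Pi.single_apply, apply_ite]
  apply LinearMap.ext
  intro f
  exact DFunLike.congr_fun h f

theorem mx_lie_mx (i j : Fin 4) : ⁅mx i, mx j⁆ = 0 := by
  apply LinearMap.ext
  intro f
  simp [Ring.lie_def, mx, mul_left_comm]

theorem pd_lie_mx (i j : Fin 4) : ⁅pd i, mx j⁆ = if i = j then 1 else 0 := by
  apply LinearMap.ext
  intro f
  simp only [Ring.lie_def, pd, mx, LinearMap.sub_apply, Module.End.mul_apply,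
    LinearMap.mulLeft_apply, Derivation.coeFn_coe, MvPolynomial.pderiv_mul,
    MvPolynomial.pderiv_X, Pi.single_apply, add_sub_cancel_right]
  split_ifs <;> simp_all

theorem mx_mul_pd_lie_pd (i j k : Fin 4) :
    ⁅mx i * pd j, pd k⁆ = if k = i then -pd j else 0 := by
  have h₁ := pd_lie_pd j k
  have h₂ := pd_lie_mx k i
  have h : ⁅mx i * pd j, pd k⁆ = mx i * ⁅pd j, pd k⁆ - ⁅pd k, mx i⁆ * pd j := by
    simp only [Ring.lie_def, mul_sub, sub_mul, mul_assoc]; abel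
  rw [h, h₁, h₂]
  split_ifs <;> simp

theorem mx_mul_pd_lie_mx_mul_pd (i j k m : Fin 4) :
    ⁅mx i * pd j, mx k * pd m⁆ =
      (if j = k then mx i * pd m else 0) - if m = i then mx k * pd j else 0 := by
  have h : ⁅mx i * pd j, mx k * pd m⁆ = mx i * ⁅pd j, mx k⁆ * pd m
      - mx k * ⁅pd m, mx i⁆ * pd j + ⁅mx i, mx k⁆ * pd j * pd m
      + mx k * mx i * ⁅pd j, pd m⁆ := by
    simp only [Ring.lie_def, mul_sub, sub_mul, mul_assoc]; abel
  rw [h, pd_lie_mx, pd_lie_mx, mx_lie_mx, pd_lie_pd]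
  split_ifs <;> simp

/-- The partners of the momenta `Pgen μ` in `rmat`. -/
def momentumPartner (l : ℝ) : Fin 4 → 𝔸 :=
  ![Ddil l, Kgen 0, Kgen 1 + Jgen 2, Kgen 2 - Jgen 1]

/-- `momentumPartner l μ` acts on momenta by `Pgen ν ↦ ∑ ρ, partnerCoeff μ ν ρ • Pgen ρ`. -/
def partnerCoeff : Fin 4 → Fin 4 → Fin 4 → ℝ :=
  ![![![1, 0, 0, 0], ![0, 1, 0, 0], ![0, 0, 1, 0], ![0, 0, 0, 1]],
    ![![0, 1, 0, 0], ![1, 0, 0, 0], ![0, 0, 0, 0], ![0, 0, 0, 0]],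
    ![![0, 0, 1, 0], ![0, 0, 1, 0], ![1, -1, 0, 0], ![0, 0, 0, 0]],
    ![![0, 0, 0, 1], ![0, 0, 0, 1], ![0, 0, 0, 0], ![1, -1, 0, 0]]]

theorem smul_one_lie (l : ℝ) (a : 𝔸) : ⁅l • (1 : 𝔸), a⁆ = 0 := by simp [Ring.lie_def]

theorem lie_smul_one (l : ℝ) (a : 𝔸) : ⁅a, l • (1 : 𝔸)⁆ = 0 := by simp [Ring.lie_def]

theorem momentumPartner_zero (l : ℝ) : momentumPartner l 0 =
    -(mx 0 * pd 0) - mx 1 * pd 1 - mx 2 * pd 2 - mx 3 * pd 3 - l • (1 : 𝔸) := by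
  simp [momentumPartner, Ddil, Fin.sum_univ_four]; abel

theorem momentumPartner_one (l : ℝ) : momentumPartner l 1 =
    -(mx 1 * pd 0) - mx 0 * pd 1 := rfl

theorem momentumPartner_two (l : ℝ) : momentumPartner l 2 =
    -(mx 2 * pd 0) - mx 0 * pd 2 + mx 2 * pd 1 - mx 1 * pd 2 := by
  simp [momentumPartner, Kgen, Jgen, eps, Fin.sum_univ_three]
  module

theorem momentumPartner_three (l : ℝ) : momentumPartner l 3 =
    -(mx 3 * pd 0) - mx 0 * pd 3 + mx 3 * pd 1 - mx 1 * pd 3 := by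
  simp [momentumPartner, Kgen, Jgen, eps, Fin.sum_univ_three]
  module

theorem momentumPartner_lie_Pgen (l : ℝ) (μ ν : Fin 4) :
    ⁅momentumPartner l μ, Pgen ν⁆ = ∑ ρ, partnerCoeff μ ν ρ • Pgen ρ := by
  fin_cases μ <;> fin_cases ν <;>
  simp [momentumPartner_zero, momentumPartner_one, momentumPartner_two, momentumPartner_three,
    Pgen, partnerCoeff, Fin.sum_univ_four, mx_mul_pd_lie_pd, smul_one_lie] <;> try module

set_option maxHeartbeats 1000000 in
theorem momentumPartner_lie_momentumPartner (l : ℝ) (μ ν : Fin 4) :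
    ⁅momentumPartner l μ, momentumPartner l ν⁆ =
      ∑ ρ, (partnerCoeff ν ρ μ - partnerCoeff μ ρ ν) • momentumPartner l ρ := by
  fin_cases μ <;> fin_cases ν <;>
  simp [momentumPartner_zero, momentumPartner_one, momentumPartner_two, momentumPartner_three,
    partnerCoeff, Fin.sum_univ_four, mx_mul_pd_lie_mx_mul_pd, smul_one_lie, lie_smul_one] <;>
    try module

end ConformalCommutators

theorem rmat_eq (z l : ℝ) : rmat z l =
    z • ∑ μ, (momentumPartner l μ ⊗ₜ[ℝ] Pgen μ - Pgen μ ⊗ₜ[ℝ] momentumPartner l μ) := by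
  simp [rmat, momentumPartner, Fin.sum_univ_four, TensorProduct.add_tmul, TensorProduct.tmul_add,
    TensorProduct.sub_tmul, TensorProduct.tmul_sub, smul_add, smul_sub]
  abel

/-- The classical r-matrix satisfies the classical Yang--Baxter equation, for every
`z ∈ ℝ` and every conformal weight `ℓ ∈ ℝ`. -/
theorem r_matrix_CYBE (z l : ℝ) :
    ⁅ι12 (rmat z l), ι13 (rmat z l)⁆ + ⁅ι12 (rmat z l), ι23 (rmat z l)⁆ +
      ⁅ι13 (rmat z l), ι23 (rmat z l)⁆ = 0 := by
  have h := classicalYangBaxter_of_quasiFrobenius (momentumPartner l) Pgen partnerCoeff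
    pd_lie_pd (momentumPartner_lie_Pgen l) (momentumPartner_lie_momentumPartner l)
    _ _ _ rfl rfl rfl
  simp only [rmat_eq, map_smul, map_sum, map_sub, ι12, ι13, ι23, TensorProduct.map_tmul,
    LinearMap.id_apply, AlgHom.toLinearMap_apply, Algebra.TensorProduct.includeLeft_apply,
    Algebra.TensorProduct.includeRight_apply]
  have hz : ∀ u v : 𝔸 ⊗[ℝ] (𝔸 ⊗[ℝ] 𝔸), ⁅z • u, z • v⁆ = (z * z) • ⁅u, v⁆ := fun u v => by
    simp only [Ring.lie_def, smul_mul_smul_comm, smul_sub]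
  rw [hz, hz, hz, ← smul_add, ← smul_add]
  exact (congrArg ((z * z) • ·) h).trans (smul_zero _)
end
end
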